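/- Let W be a rectangle contained in a plane h in ℝ³, and let W₀ be the orthogonal projection of W onto the xy-plane. Then there is a rigid motion (isometry) of the plane taking a congruent copy of W into the xy-plane so that this copy contains W₀. -/

import Mathlib

/-- A parallelogram with sides `(r, 0)` and `(d, w)` in the first quadrant has widths at most `a` and
`b` along some orthonormal frame, provided that its sides are at most `a` and `b` and its long
diagonal is at most that of the `a × b` rectangle. -/
theorem exists_frame_width_le_of_horizontal {a b r d w : ℝ} (ha : 0 ≤ a) (hb : 0 ≤ b)
    (hr : 0 ≤ r) (hd : 0 ≤ d) (hw : 0 ≤ w) (hra : r ≤ a) (hV : d ^ 2 + w ^ 2 ≤ b ^ 2)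
    (hUV : (r + d) ^ 2 + w ^ 2 ≤ a ^ 2 + b ^ 2) :
    ∃ p q : ℝ, p ^ 2 + q ^ 2 = 1 ∧ |r * p| + |d * p + w * q| ≤ a ∧
      |r * q| + |w * p - d * q| ≤ b := by
  by_cases hA : r + d ≤ a
  · refine ⟨1, 0, by norm_num, ?_, ?_⟩
    · simpa [abs_of_nonneg, hr, hd] using hA
    · simpa [abs_of_nonneg hw] using
        (abs_le_of_sq_le_sq' (by linarith [sq_nonneg d]) hb : -b ≤ w ∧ w ≤ b).2
  push Not at hA
  set N := (r + d) ^ 2 + w ^ 2 with hN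
  have hTa : a ^ 2 < (r + d) ^ 2 := pow_lt_pow_left₀ hA ha two_ne_zero
  have hNa : a ^ 2 < N := by linarith [sq_nonneg w]
  have hN0 : 0 < N := lt_of_le_of_lt (sq_nonneg a) hNa
  obtain ⟨k, hk, hk2⟩ : ∃ k : ℝ, 0 ≤ k ∧ k ^ 2 = N - a ^ 2 :=
    ⟨√(N - a ^ 2), Real.sqrt_nonneg _, Real.sq_sqrt (by linarith)⟩
  have hkb : k ≤ b := abs_le_of_sq_le_sq' (by linarith) hb |>.2
  -- In the frame `(p, q)`, `(-q, p)` the long diagonal is `(a, k)`.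
  obtain ⟨p, hp⟩ : ∃ p, p = (a * (r + d) + k * w) / N := ⟨_, rfl⟩
  obtain ⟨q, hq⟩ : ∃ q, q = (a * w - k * (r + d)) / N := ⟨_, rfl⟩
  have hpq : p ^ 2 + q ^ 2 = 1 := by
    rw [hp, hq, div_pow, div_pow, ← add_div, div_eq_one_iff_eq (by positivity)]
    linear_combination N * hk2 - (a ^ 2 + k ^ 2) * hN
  have hTp : (r + d) * p + w * q = a := by
    rw [hp, hq]; field_simp; rw [hN]; ring
  have hTq : w * p - (r + d) * q = k := by
    rw [hp, hq]; field_simp; rw [hN]; ring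
  have hp0 : 0 ≤ p := by rw [hp]; positivity
  have hq0 : q ≤ 0 := by
    rw [hq]
    refine div_nonpos_of_nonpos_of_nonneg (sub_nonpos.2 ?_) hN0.le
    refine abs_le_of_sq_le_sq' ?_ (by positivity) |>.2
    rw [mul_pow, mul_pow, hk2]
    linear_combination N * hTa.le + a ^ 2 * hN
  have hp1 : p ≤ 1 := abs_le_of_sq_le_sq' (by linarith [sq_nonneg q]) zero_le_one |>.2
  have hrp : r * p ≤ a := (mul_le_of_le_one_right hr hp1).trans hra
  have hVq : 0 ≤ w * p - d * q := by
    linarith [mul_nonneg hw hp0, mul_nonneg hd (neg_nonneg.2 hq0)]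
  refine ⟨p, q, hpq, ?_, ?_⟩
  · rw [abs_of_nonneg (mul_nonneg hr hp0), abs_of_nonneg (by linarith)]
    linarith
  · rw [abs_of_nonpos (mul_nonpos_of_nonneg_of_nonpos hr hq0), abs_of_nonneg hVq]
    linarith

theorem exists_polar_coordinates (x y : ℝ) : ∃ r c s : ℝ,
    0 ≤ r ∧ r ^ 2 = x ^ 2 + y ^ 2 ∧ c ^ 2 + s ^ 2 = 1 ∧ x = r * c ∧ y = r * s := by
  refine ⟨‖(⟨x, y⟩ : ℂ)‖, Real.cos (Complex.arg ⟨x, y⟩), Real.sin (Complex.arg ⟨x, y⟩),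
    norm_nonneg _, ?_, Real.cos_sq_add_sin_sq _, ?_, ?_⟩
  · rw [Complex.sq_norm, Complex.normSq_mk]; ring
  · rw [Complex.norm_mul_cos_arg]
  · rw [Complex.norm_mul_sin_arg]

/-- A parallelogram with sides `U = (u₁, u₂)` and `V = (v₁, v₂)`, where `U × V ≥ 0` and `U ⬝ V ≥ 0`,
has widths at most `a` and `b` along some orthonormal frame, provided that its sides are at most `a`
and `b` and its long diagonal is at most that of the `a × b` rectangle. -/
theorem exists_frame_width_le_of_nonneg {a b u₁ u₂ v₁ v₂ : ℝ} (ha : 0 ≤ a) (hb : 0 ≤ b)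
    (hU : u₁ ^ 2 + u₂ ^ 2 ≤ a ^ 2) (hV : v₁ ^ 2 + v₂ ^ 2 ≤ b ^ 2)
    (hUV : (u₁ + v₁) ^ 2 + (u₂ + v₂) ^ 2 ≤ a ^ 2 + b ^ 2)
    (hdot : 0 ≤ u₁ * v₁ + u₂ * v₂) (hdet : 0 ≤ u₁ * v₂ - u₂ * v₁) :
    ∃ c s : ℝ, c ^ 2 + s ^ 2 = 1 ∧ |u₁ * c + u₂ * s| + |v₁ * c + v₂ * s| ≤ a ∧
      |u₂ * c - u₁ * s| + |v₂ * c - v₁ * s| ≤ b := by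
  obtain ⟨r, c, s, hr, hr2, hcs, rfl, rfl⟩ := exists_polar_coordinates u₁ u₂
  have hra : r ≤ a := abs_le_of_sq_le_sq' (by rw [hr2]; exact hU) ha |>.2
  rcases hr.eq_or_lt with rfl | hr0
  · obtain ⟨t, e, f, ht, ht2, hef, rfl, rfl⟩ := exists_polar_coordinates v₁ v₂
    have htb : t ≤ b := abs_le_of_sq_le_sq' (by rw [ht2]; exact hV) hb |>.2
    refine ⟨f, -e, by linarith, ?_, ?_⟩
    · rw [show t * e * f + t * f * -e = 0 by ring]
      simpa using ha
    · rw [show t * f * f - t * e * -e = t by linear_combination t * hef, abs_of_nonneg ht]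
      simpa using htb
  have hd : 0 ≤ v₁ * c + v₂ * s := nonneg_of_mul_nonneg_right (by linarith) hr0
  have hw : 0 ≤ v₂ * c - v₁ * s := nonneg_of_mul_nonneg_right (by linarith) hr0
  obtain ⟨p, q, hpq, h₁, h₂⟩ := exists_frame_width_le_of_horizontal ha hb hr hd hw hra
    (by linear_combination hV + (v₁ ^ 2 + v₂ ^ 2) * hcs)
    (by linear_combination hUV + (v₁ ^ 2 + v₂ ^ 2) * hcs + hr2)
  refine ⟨c * p - s * q, s * p + c * q, ?_, ?_, ?_⟩
  · linear_combination (p ^ 2 + q ^ 2) * hcs + hpq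
  · convert h₁ using 3
    · linear_combination r * p * hcs
    · ring
  · rw [← abs_neg (r * q)] at h₂
    convert h₂ using 3
    · linear_combination -r * q * hcs
    · ring

/-- A parallelogram whose sides are at most `a` and `b` and whose diagonals are at most that of the
`a × b` rectangle has widths at most `a` and `b` along some orthonormal frame. -/
theorem exists_frame_width_le {a b u₁ u₂ v₁ v₂ : ℝ} (ha : 0 ≤ a) (hb : 0 ≤ b)
    (hU : u₁ ^ 2 + u₂ ^ 2 ≤ a ^ 2) (hV : v₁ ^ 2 + v₂ ^ 2 ≤ b ^ 2)
    (hadd : (u₁ + v₁) ^ 2 + (u₂ + v₂) ^ 2 ≤ a ^ 2 + b ^ 2)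
    (hsub : (u₁ - v₁) ^ 2 + (u₂ - v₂) ^ 2 ≤ a ^ 2 + b ^ 2) :
    ∃ c s : ℝ, c ^ 2 + s ^ 2 = 1 ∧ |u₁ * c + u₂ * s| + |v₁ * c + v₂ * s| ≤ a ∧
      |u₂ * c - u₁ * s| + |v₂ * c - v₁ * s| ≤ b := by
  wlog hdot : 0 ≤ u₁ * v₁ + u₂ * v₂ generalizing v₁ v₂
  · obtain ⟨c, s, hcs, h₁, h₂⟩ := this (v₁ := -v₁) (v₂ := -v₂) (by linarith) (by linarith)
      (by linarith) (by linarith)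
    refine ⟨c, s, hcs, ?_, ?_⟩
    · rwa [← abs_neg (v₁ * c + v₂ * s), show -(v₁ * c + v₂ * s) = -v₁ * c + -v₂ * s by ring]
    · rwa [← abs_neg (v₂ * c - v₁ * s), show -(v₂ * c - v₁ * s) = -v₂ * c - -v₁ * s by ring]
  rcases le_total 0 (u₁ * v₂ - u₂ * v₁) with hdet | hdet
  · exact exists_frame_width_le_of_nonneg ha hb hU hV hadd hdot hdet
  · obtain ⟨c, s, hcs, h₁, h₂⟩ := exists_frame_width_le_of_nonneg (u₁ := u₁) (u₂ := -u₂)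
      (v₁ := v₁) (v₂ := -v₂) ha hb (by linarith) (by linarith) (by linarith) (by linarith)
      (by linarith)
    refine ⟨c, -s, by linarith, ?_, ?_⟩
    · simpa only [neg_mul, mul_neg] using h₁
    · rw [← abs_neg, ← abs_neg (v₂ * c - v₁ * -s)]
      convert h₂ using 3 <;> ring

/-- The rotation of the plane taking the standard basis to `(c, s)`, `(-s, c)`. -/
noncomputable def planeRotation (c s : ℝ) (h : c ^ 2 + s ^ 2 = 1) :
    EuclideanSpace ℝ (Fin 2) ≃ₗᵢ[ℝ] EuclideanSpace ℝ (Fin 2) :=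
  LinearIsometry.toLinearIsometryEquiv
    { toFun := fun y => !₂[c * y 0 - s * y 1, s * y 0 + c * y 1]
      map_add' := fun x y => by
        ext i; fin_cases i <;> simp <;> ring
      map_smul' := fun t x => by
        ext i; fin_cases i <;> simp <;> ring
      norm_map' := fun y => by
        simp only [EuclideanSpace.norm_eq, LinearMap.coe_mk, AddHom.coe_mk, Fin.sum_univ_two,
          Real.norm_eq_abs, sq_abs]
        congr 1
        simp
        linear_combination (y 0 ^ 2 + y 1 ^ 2) * h } rfl

theorem planeRotation_apply (c s : ℝ) (h : c ^ 2 + s ^ 2 = 1) (y : EuclideanSpace ℝ (Fin 2)) :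
    planeRotation c s h y = !₂[c * y 0 - s * y 1, s * y 0 + c * y 1] := rfl

theorem abs_mul_add_mul_le_half {a b x y m n w : ℝ} (hx : x ∈ Set.Icc 0 a) (hy : y ∈ Set.Icc 0 b)
    (h : |a * m| + |b * n| ≤ w) : |(x - a / 2) * m + (y - b / 2) * n| ≤ w / 2 := by
  have hxa : |x - a / 2| ≤ |a| / 2 := by
    rw [abs_of_nonneg (hx.1.trans hx.2), abs_le]; constructor <;> linarith [hx.1, hx.2]
  have hyb : |y - b / 2| ≤ |b| / 2 := by
    rw [abs_of_nonneg (hy.1.trans hy.2), abs_le]; constructor <;> linarith [hy.1, hy.2]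
  rw [abs_mul, abs_mul] at h
  refine (abs_add_le _ _).trans ?_
  rw [abs_mul, abs_mul]
  nlinarith [mul_le_mul_of_nonneg_right hxa (abs_nonneg m),
    mul_le_mul_of_nonneg_right hyb (abs_nonneg n)]

/-- Every rectangle can cover its shadows: if `W = φ '' R` is a rectangle lying in a plane
of `ℝ³` (the isometric image of the planar rectangle `R = [0,a] × [0,b]`), and `W₀` is the
orthogonal projection of `W` onto the `xy`-plane, then some congruent copy of the rectangle
(a rigid image `g '' R` of `R` in the plane) contains `W₀`. -/
theorem rectangle_covers_its_shadow (a b : ℝ) (ha : 0 ≤ a) (hb : 0 ≤ b)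
    (φ : EuclideanSpace ℝ (Fin 2) →ᵃⁱ[ℝ] EuclideanSpace ℝ (Fin 3))
    (R : Set (EuclideanSpace ℝ (Fin 2)))
    (hR : R = {x : EuclideanSpace ℝ (Fin 2) | x 0 ∈ Set.Icc 0 a ∧ x 1 ∈ Set.Icc 0 b})
    (proj : EuclideanSpace ℝ (Fin 3) → EuclideanSpace ℝ (Fin 2))
    (hproj : ∀ x : EuclideanSpace ℝ (Fin 3),
      proj x = (WithLp.equiv 2 (Fin 2 → ℝ)).symm ![x 0, x 1]) :
    ∃ g : EuclideanSpace ℝ (Fin 2) ≃ᵃⁱ[ℝ] EuclideanSpace ℝ (Fin 2),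
      proj '' (φ '' R) ⊆ g '' R := by
  set u := φ.linearIsometry (EuclideanSpace.single 0 1) with hu
  set v := φ.linearIsometry (EuclideanSpace.single 1 1) with hv
  have hφ : ∀ x i, φ x i = x 0 * u i + x 1 * v i + φ 0 i := by
    intro x i
    have hx : x = x 0 • EuclideanSpace.single 0 (1 : ℝ) + x 1 • EuclideanSpace.single 1 (1 : ℝ) := by
      ext j; fin_cases j <;> simp
    have h := φ.map_vadd 0 x
    rw [vadd_eq_add, vadd_eq_add, add_zero] at h
    rw [h]
    conv_lhs => rw [hx]
    simp [hu, hv]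
  have huu : u 0 ^ 2 + u 1 ^ 2 + u 2 ^ 2 = 1 := by
    have h : ‖u‖ = 1 := by rw [hu, LinearIsometry.norm_map]; simp
    rw [← sq_eq_sq₀ (norm_nonneg _) zero_le_one, EuclideanSpace.real_norm_sq_eq,
      Fin.sum_univ_three] at h
    linarith
  have hvv : v 0 ^ 2 + v 1 ^ 2 + v 2 ^ 2 = 1 := by
    have h : ‖v‖ = 1 := by rw [hv, LinearIsometry.norm_map]; simp
    rw [← sq_eq_sq₀ (norm_nonneg _) zero_le_one, EuclideanSpace.real_norm_sq_eq,
      Fin.sum_univ_three] at h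
    linarith
  have huv : u 0 * v 0 + u 1 * v 1 + u 2 * v 2 = 0 := by
    have h : inner ℝ u v = 0 := by
      rw [hu, hv, LinearIsometry.inner_map_map]; simp [EuclideanSpace.inner_single_left]
    simp [PiLp.inner_apply, Fin.sum_univ_three] at h
    linarith
  obtain ⟨c, s, hcs, h₁, h₂⟩ := exists_frame_width_le (u₁ := a * u 0) (u₂ := a * u 1)
    (v₁ := b * v 0) (v₂ := b * v 1) ha hb
    (by linear_combination a ^ 2 * huu + sq_nonneg (a * u 2))
    (by linear_combination b ^ 2 * hvv + sq_nonneg (b * v 2))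
    (by linear_combination a ^ 2 * huu + b ^ 2 * hvv + 2 * a * b * huv +
      sq_nonneg (a * u 2 + b * v 2))
    (by linear_combination a ^ 2 * huu + b ^ 2 * hvv - 2 * a * b * huv +
      sq_nonneg (a * u 2 - b * v 2))
  set g₀ := planeRotation c s hcs
  obtain ⟨m, hm₀, hm₁⟩ : ∃ m : EuclideanSpace ℝ (Fin 2), m 0 = a / 2 ∧ m 1 = b / 2 :=
    ⟨!₂[a / 2, b / 2], rfl, rfl⟩
  refine ⟨g₀.toAffineIsometryEquiv.trans (AffineIsometryEquiv.constVAdd ℝ _ (proj (φ m) - g₀ m)), ?_⟩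
  subst hR
  rintro _ ⟨_, ⟨x, ⟨hx, hy⟩, rfl⟩, rfl⟩
  have hw₁ := abs_le.1 <| abs_mul_add_mul_le_half (m := u 0 * c + u 1 * s)
    (n := v 0 * c + v 1 * s) (w := a) hx hy (by convert h₁ using 3 <;> ring)
  have hw₂ := abs_le.1 <| abs_mul_add_mul_le_half (m := u 1 * c - u 0 * s)
    (n := v 1 * c - v 0 * s) (w := b) hx hy (by convert h₂ using 3 <;> ring)
  refine ⟨!₂[a / 2 + ((x 0 - a / 2) * (u 0 * c + u 1 * s) + (x 1 - b / 2) * (v 0 * c + v 1 * s)),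
    b / 2 + ((x 0 - a / 2) * (u 1 * c - u 0 * s) + (x 1 - b / 2) * (v 1 * c - v 0 * s))],
    ⟨⟨?_, ?_⟩, ⟨?_, ?_⟩⟩, ?_⟩
  · simp; linarith
  · simp; linarith
  · simp; linarith
  · simp; linarith
  · ext i
    fin_cases i
    · simp [g₀, planeRotation_apply, hproj, hφ x, hφ m, hm₀, hm₁]
      linear_combination
        ((x 0 - a / 2) * u 0 + (x 1 - b / 2) * v 0) * hcs
    · simp [g₀, planeRotation_apply, hproj, hφ x, hφ m, hm₀, hm₁]
      linear_combination
        ((x 0 - a / 2) * u 1 + (x 1 - b / 2) * v 1) * hcs
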